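/- arXiv:2205.08829 — 3 statements merged into one kernel-verified Lean document; each statement's English description precedes it below -/
import Mathlib

section
/- Let λ, c > 0 be real constants and let f₀, f₁, f₂ : ℝ³ → ℝ be three-times continuously differentiable functions of (t,x,y) satisfying: ∂f₀/∂t = −c ∂f₀/∂x + (λ/4)(f₁+f₂−4f₀); ∂f₁/∂t = −c ∂f₁/∂y + (λ/4)(f₀+f₂−4f₁); ∂f₂/∂t = (λ/4)(f₀+f₁−4f₂). Then p = f₀+f₁+f₂ satisfies the third-order equation ∂³p/∂t³ + 3λ ∂²p/∂t² + (45λ²/16) ∂p/∂t + (25λ³/32) p = −c (∂/∂x + ∂/∂y)(∂²/∂t² + 2λ ∂/∂t + (15/16)λ²) p − c² ∂²/(∂x∂y) (∂/∂t + λ) p. -/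
/-- Partial derivative in the first (time) variable of a function of three real variables. -/
noncomputable def pt3 (f : ℝ → ℝ → ℝ → ℝ) : ℝ → ℝ → ℝ → ℝ :=
  fun t x y => deriv (fun s => f s x y) t

/-- Partial derivative in the second (x) variable. -/
noncomputable def px3 (f : ℝ → ℝ → ℝ → ℝ) : ℝ → ℝ → ℝ → ℝ :=
  fun t x y => deriv (fun s => f t s y) x

/-- Partial derivative in the third (y) variable. -/
noncomputable def py3 (f : ℝ → ℝ → ℝ → ℝ) : ℝ → ℝ → ℝ → ℝ :=
  fun t x y => deriv (fun s => f t x s) y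

section DirectionalDerivative

variable {E : Type*} [NormedAddCommGroup E] [NormedSpace ℝ E] {F G : E → ℝ}

/-- The derivative of `F` in the constant direction `v`. -/
noncomputable def dirDeriv (v : E) (F : E → ℝ) : E → ℝ := fun q => fderiv ℝ F q v

theorem contDiff_dirDeriv {n : ℕ} (hF : ContDiff ℝ (n + 1) F) (v : E) :
    ContDiff ℝ n (dirDeriv v F) :=
  (hF.fderiv_right le_rfl).clm_apply contDiff_const

theorem dirDeriv_add (hF : Differentiable ℝ F) (hG : Differentiable ℝ G) (v : E) :
    dirDeriv v (F + G) = dirDeriv v F + dirDeriv v G := by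
  ext q
  simp [dirDeriv, fderiv_add (hF q) (hG q)]

theorem dirDeriv_smul (hF : Differentiable ℝ F) (a : ℝ) (v : E) :
    dirDeriv v (a • F) = a • dirDeriv v F := by
  ext q
  simp [dirDeriv, fderiv_const_smul (hF q)]

theorem dirDeriv_add_left (v w : E) : dirDeriv (v + w) F = dirDeriv v F + dirDeriv w F := by
  ext q
  simp [dirDeriv]

theorem dirDeriv_smul_left (a : ℝ) (v : E) : dirDeriv (a • v) F = a • dirDeriv v F := by
  ext q
  simp [dirDeriv]

theorem dirDeriv_comm (hF : ContDiff ℝ 2 F) (v w : E) :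
    dirDeriv v (dirDeriv w F) = dirDeriv w (dirDeriv v F) := by
  ext q
  have hd : DifferentiableAt ℝ (fderiv ℝ F) q :=
    ((hF.fderiv_right (m := 1) (by norm_num)).differentiable (by norm_num)) q
  have key (v w : E) : dirDeriv v (dirDeriv w F) q = fderiv ℝ (fderiv ℝ F) q v w := by
    unfold dirDeriv
    rw [fderiv_clm_apply hd (differentiableAt_const w)]
    simp
  rw [key, key]
  exact (hF.contDiffAt.isSymmSndFDerivAt (by simp)) v w

/-- The first-order operator `∂ᵥ + μ`. -/
noncomputable def transportOp (μ : ℝ) (v : E) (F : E → ℝ) : E → ℝ := dirDeriv v F + μ • F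

theorem contDiff_transportOp {n : ℕ} (hF : ContDiff ℝ (n + 1) F) (μ : ℝ) (v : E) :
    ContDiff ℝ n (transportOp μ v F) :=
  (contDiff_dirDeriv hF v).add ((hF.of_le (by exact_mod_cast Nat.le_succ n)).const_smul μ)

theorem transportOp_add (hF : Differentiable ℝ F) (hG : Differentiable ℝ G) (μ : ℝ) (v : E) :
    transportOp μ v (F + G) = transportOp μ v F + transportOp μ v G := by
  simp only [transportOp, dirDeriv_add hF hG]
  module

theorem transportOp_smul (hF : Differentiable ℝ F) (a μ : ℝ) (v : E) :
    transportOp μ v (a • F) = a • transportOp μ v F := by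
  simp only [transportOp, dirDeriv_smul hF]
  module

theorem transportOp_transportOp (hF : ContDiff ℝ 2 F) (μ : ℝ) (v w : E) :
    transportOp μ v (transportOp μ w F) =
      dirDeriv v (dirDeriv w F) + μ • (dirDeriv v F + dirDeriv w F) + μ ^ 2 • F := by
  have hd : Differentiable ℝ F := hF.differentiable (by norm_num)
  have hw : Differentiable ℝ (dirDeriv w F) :=
    (contDiff_dirDeriv (n := 1) hF w).differentiable (by norm_num)
  simp only [transportOp]
  rw [dirDeriv_add hw (hd.const_smul μ), dirDeriv_smul hd]
  module

theorem transportOp_comm (hF : ContDiff ℝ 2 F) (μ : ℝ) (v w : E) :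
    transportOp μ v (transportOp μ w F) = transportOp μ w (transportOp μ v F) := by
  rw [transportOp_transportOp hF, transportOp_transportOp hF, dirDeriv_comm hF v w,
    add_comm (dirDeriv v F)]

/-- Elimination of the components from a mean-field system of three transport equations. -/
theorem transportOp_elimination {μ k : ℝ} {v₀ v₁ v₂ : E} {F₀ F₁ F₂ P : E → ℝ}
    (h₀ : ContDiff ℝ 3 F₀) (h₁ : ContDiff ℝ 3 F₁) (h₂ : ContDiff ℝ 3 F₂)
    (hP : P = F₀ + F₁ + F₂) (e₀ : transportOp μ v₀ F₀ = k • P)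
    (e₁ : transportOp μ v₁ F₁ = k • P) (e₂ : transportOp μ v₂ F₂ = k • P) :
    transportOp μ v₀ (transportOp μ v₁ (transportOp μ v₂ P)) =
      k • (transportOp μ v₁ (transportOp μ v₂ P) + transportOp μ v₀ (transportOp μ v₂ P) +
        transportOp μ v₀ (transportOp μ v₁ P)) := by
  have d3 {F : E → ℝ} (h : ContDiff ℝ 3 F) : Differentiable ℝ F :=
    h.differentiable (by norm_num)
  have c2 {F : E → ℝ} (h : ContDiff ℝ 3 F) : ContDiff ℝ 2 F := h.of_le (by norm_num)
  have t2 {F : E → ℝ} (h : ContDiff ℝ 3 F) (v : E) : ContDiff ℝ 2 (transportOp μ v F) :=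
    contDiff_transportOp (n := 2) h μ v
  have d2 {F : E → ℝ} (h : ContDiff ℝ 3 F) (v : E) : Differentiable ℝ (transportOp μ v F) :=
    (t2 h v).differentiable (by norm_num)
  have d1 {F : E → ℝ} (h : ContDiff ℝ 3 F) (v w : E) :
      Differentiable ℝ (transportOp μ w (transportOp μ v F)) :=
    (contDiff_transportOp (n := 1) (t2 h v) μ w).differentiable (by norm_num)
  have h₃ : ContDiff ℝ 3 P := hP ▸ (h₀.add h₁).add h₂
  have pull (v w : E) : transportOp μ v (transportOp μ w (k • P)) =
      k • transportOp μ v (transportOp μ w P) := by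
    rw [transportOp_smul (d3 h₃), transportOp_smul (d2 h₃ w)]
  have split : transportOp μ v₀ (transportOp μ v₁ (transportOp μ v₂ P)) =
      transportOp μ v₀ (transportOp μ v₁ (transportOp μ v₂ F₀)) +
      transportOp μ v₀ (transportOp μ v₁ (transportOp μ v₂ F₁)) +
      transportOp μ v₀ (transportOp μ v₁ (transportOp μ v₂ F₂)) := by
    rw [hP, transportOp_add ((d3 h₀).add (d3 h₁)) (d3 h₂), transportOp_add (d3 h₀) (d3 h₁),
      transportOp_add ((d2 h₀ _).add (d2 h₁ _)) (d2 h₂ _),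
      transportOp_add (d2 h₀ _) (d2 h₁ _),
      transportOp_add ((d1 h₀ _ _).add (d1 h₁ _ _)) (d1 h₂ _ _),
      transportOp_add (d1 h₀ _ _) (d1 h₁ _ _)]
  rw [split, transportOp_comm (t2 h₀ v₂) μ v₀ v₁, transportOp_comm (c2 h₀) μ v₀ v₂, e₀,
    transportOp_comm (c2 h₁) μ v₁ v₂, e₁, e₂, pull, pull, pull]
  module

/-- The eliminated equation for two perturbed directions `u + c • v`, `u + c • w` and `u`,
written out in terms of derivatives along `u`, `v` and `w`. -/
theorem transportOp_elimination_expand {μ k c : ℝ} {u v w : E} {P : E → ℝ}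
    (h : ContDiff ℝ 3 P)
    (he : transportOp μ (u + c • v) (transportOp μ (u + c • w) (transportOp μ u P)) =
      k • (transportOp μ (u + c • w) (transportOp μ u P) +
        transportOp μ (u + c • v) (transportOp μ u P) +
        transportOp μ (u + c • v) (transportOp μ (u + c • w) P))) :
    dirDeriv u (dirDeriv u (dirDeriv u P)) + (3 * μ - 3 * k) • dirDeriv u (dirDeriv u P) +
        (3 * μ ^ 2 - 6 * k * μ) • dirDeriv u P + (μ ^ 3 - 3 * k * μ ^ 2) • P =
      -c • (dirDeriv v (dirDeriv u (dirDeriv u P) + (2 * μ - 2 * k) • dirDeriv u P +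
          (μ ^ 2 - 2 * k * μ) • P) +
        dirDeriv w (dirDeriv u (dirDeriv u P) + (2 * μ - 2 * k) • dirDeriv u P +
          (μ ^ 2 - 2 * k * μ) • P)) -
      c ^ 2 • dirDeriv v (dirDeriv w (dirDeriv u P + (μ - k) • P)) := by
  have c2 : ContDiff ℝ 2 P := h.of_le (by norm_num)
  have d0 : Differentiable ℝ P := h.differentiable (by norm_num)
  have t1 (a : E) : ContDiff ℝ 2 (dirDeriv a P) := contDiff_dirDeriv (n := 2) h a
  have d1 (a : E) : Differentiable ℝ (dirDeriv a P) := (t1 a).differentiable (by norm_num)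
  have d2 (a b : E) : Differentiable ℝ (dirDeriv b (dirDeriv a P)) :=
    (contDiff_dirDeriv (n := 1) (t1 a) b).differentiable (by norm_num)
  have D1 (a : E) (r : ℝ) : dirDeriv a (dirDeriv u P + r • P) =
      dirDeriv a (dirDeriv u P) + r • dirDeriv a P := by
    rw [dirDeriv_add (d1 u) (d0.const_smul r), dirDeriv_smul d0]
  have D2 (a : E) (r s : ℝ) :
      dirDeriv a (dirDeriv u (dirDeriv u P) + r • dirDeriv u P + s • P) =
      dirDeriv a (dirDeriv u (dirDeriv u P)) + r • dirDeriv a (dirDeriv u P) +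
        s • dirDeriv a P := by
    rw [dirDeriv_add ((d2 u u).add ((d1 u).const_smul r)) (d0.const_smul s),
      dirDeriv_add (d2 u u) ((d1 u).const_smul r), dirDeriv_smul (d1 u), dirDeriv_smul d0]
  have E1 (r : ℝ) : dirDeriv v (dirDeriv w (dirDeriv u P + r • P)) =
      dirDeriv v (dirDeriv w (dirDeriv u P)) + r • dirDeriv v (dirDeriv w P) := by
    rw [D1, dirDeriv_add (d2 u w) ((d1 w).const_smul r), dirDeriv_smul (d1 w)]
  have L (a b : E) : dirDeriv a (dirDeriv (u + c • b) P) =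
      dirDeriv a (dirDeriv u P) + c • dirDeriv a (dirDeriv b P) := by
    rw [dirDeriv_add_left, dirDeriv_smul_left, dirDeriv_add (d1 u) ((d1 b).const_smul c),
      dirDeriv_smul (d1 b)]
  have M (a b : E) : dirDeriv a (dirDeriv (u + c • b) (dirDeriv u P)) =
      dirDeriv a (dirDeriv u (dirDeriv u P)) + c • dirDeriv a (dirDeriv b (dirDeriv u P)) := by
    rw [dirDeriv_add_left, dirDeriv_smul_left, dirDeriv_add (d2 u u) ((d2 u b).const_smul c),
      dirDeriv_smul (d2 u b)]
  have third (a b : E) : transportOp μ a (transportOp μ b (transportOp μ u P)) =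
      dirDeriv a (dirDeriv b (dirDeriv u P)) + μ • (dirDeriv a (dirDeriv b P) +
        dirDeriv a (dirDeriv u P) + dirDeriv b (dirDeriv u P)) +
      μ ^ 2 • (dirDeriv a P + dirDeriv b P + dirDeriv u P) + μ ^ 3 • P := by
    rw [transportOp_transportOp (contDiff_transportOp (n := 2) h μ u)]
    unfold transportOp
    rw [D1, D1, dirDeriv_add (d2 u b) ((d1 b).const_smul μ), dirDeriv_smul (d1 b)]
    module
  rw [third, transportOp_transportOp c2, transportOp_transportOp c2,
    transportOp_transportOp c2] at he
  rw [D2, D2, E1]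
  simp only [dirDeriv_add_left (v := u), dirDeriv_smul_left] at he L M
  simp only [L, M, dirDeriv_comm (t1 u) u w, dirDeriv_comm c2 u w] at he
  ext q
  have hq := congrFun he q
  simp only [Pi.add_apply, Pi.smul_apply, Pi.sub_apply, smul_eq_mul] at hq ⊢
  linear_combination hq

end DirectionalDerivative

theorem pt3_curry {F : ℝ × ℝ × ℝ → ℝ} (hF : Differentiable ℝ F) :
    pt3 (fun t x y => F (t, x, y)) = fun t x y => dirDeriv (1, 0, 0) F (t, x, y) := by
  ext t x y
  have hc : HasDerivAt (fun s : ℝ => (s, x, y)) ((1 : ℝ), (0 : ℝ), (0 : ℝ)) t :=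
    (hasDerivAt_id t).prodMk (hasDerivAt_const t (x, y))
  exact ((hF (t, x, y)).hasFDerivAt.comp_hasDerivAt t hc).deriv

theorem px3_curry {F : ℝ × ℝ × ℝ → ℝ} (hF : Differentiable ℝ F) :
    px3 (fun t x y => F (t, x, y)) = fun t x y => dirDeriv (0, 1, 0) F (t, x, y) := by
  ext t x y
  have hc : HasDerivAt (fun s : ℝ => (t, s, y)) ((0 : ℝ), (1 : ℝ), (0 : ℝ)) x :=
    (hasDerivAt_const x t).prodMk ((hasDerivAt_id x).prodMk (hasDerivAt_const x y))
  exact ((hF (t, x, y)).hasFDerivAt.comp_hasDerivAt x hc).deriv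

theorem py3_curry {F : ℝ × ℝ × ℝ → ℝ} (hF : Differentiable ℝ F) :
    py3 (fun t x y => F (t, x, y)) = fun t x y => dirDeriv (0, 0, 1) F (t, x, y) := by
  ext t x y
  have hc : HasDerivAt (fun s : ℝ => (t, x, s)) ((0 : ℝ), (0 : ℝ), (1 : ℝ)) y :=
    (hasDerivAt_const y t).prodMk ((hasDerivAt_const y x).prodMk (hasDerivAt_id y))
  exact ((hF (t, x, y)).hasFDerivAt.comp_hasDerivAt y hc).deriv

theorem face_third_order_equation
    (lam c : ℝ) (hlam : 0 < lam) (hc : 0 < c)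
    (f0 f1 f2 : ℝ → ℝ → ℝ → ℝ)
    (hf0 : ContDiff ℝ 3 (fun p : ℝ × ℝ × ℝ => f0 p.1 p.2.1 p.2.2))
    (hf1 : ContDiff ℝ 3 (fun p : ℝ × ℝ × ℝ => f1 p.1 p.2.1 p.2.2))
    (hf2 : ContDiff ℝ 3 (fun p : ℝ × ℝ × ℝ => f2 p.1 p.2.1 p.2.2))
    (heq0 : ∀ t x y, pt3 f0 t x y =
      -c * px3 f0 t x y + (lam / 4) * (f1 t x y + f2 t x y - 4 * f0 t x y))
    (heq1 : ∀ t x y, pt3 f1 t x y =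
      -c * py3 f1 t x y + (lam / 4) * (f0 t x y + f2 t x y - 4 * f1 t x y))
    (heq2 : ∀ t x y, pt3 f2 t x y =
      (lam / 4) * (f0 t x y + f1 t x y - 4 * f2 t x y))
    (p : ℝ → ℝ → ℝ → ℝ)
    (hp : p = fun t x y => f0 t x y + f1 t x y + f2 t x y) :
    ∀ t x y,
      pt3 (pt3 (pt3 p)) t x y + 3 * lam * pt3 (pt3 p) t x y
        + (45 * lam ^ 2 / 16) * pt3 p t x y + (25 * lam ^ 3 / 32) * p t x y
      = -c * (px3 (fun t x y => pt3 (pt3 p) t x y + 2 * lam * pt3 p t x y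
            + (15 / 16) * lam ^ 2 * p t x y) t x y
          + py3 (fun t x y => pt3 (pt3 p) t x y + 2 * lam * pt3 p t x y
            + (15 / 16) * lam ^ 2 * p t x y) t x y)
        - c ^ 2 * px3 (py3 (fun t x y => pt3 p t x y + lam * p t x y)) t x y := by
  set F0 : ℝ × ℝ × ℝ → ℝ := fun q => f0 q.1 q.2.1 q.2.2
  set F1 : ℝ × ℝ × ℝ → ℝ := fun q => f1 q.1 q.2.1 q.2.2
  set F2 : ℝ × ℝ × ℝ → ℝ := fun q => f2 q.1 q.2.1 q.2.2
  set u : ℝ × ℝ × ℝ := (1, 0, 0)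
  set v : ℝ × ℝ × ℝ := (0, 1, 0)
  set w : ℝ × ℝ × ℝ := (0, 0, 1)
  obtain ⟨P, hP⟩ : ∃ P, P = F0 + F1 + F2 := ⟨_, rfl⟩
  have hpP : p = fun t x y => P (t, x, y) := by rw [hp, hP]; rfl
  have hP3 : ContDiff ℝ 3 P := hP ▸ (hf0.add hf1).add hf2
  have diff {F : ℝ × ℝ × ℝ → ℝ} (h : ContDiff ℝ 3 F) : Differentiable ℝ F :=
    h.differentiable (by norm_num)
  have e0 : transportOp (5 * lam / 4) (u + c • v) F0 = (lam / 4) • P := by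
    ext ⟨t, x, y⟩
    have h := heq0 t x y
    change pt3 (fun t x y => F0 (t, x, y)) t x y = -c * px3 (fun t x y => F0 (t, x, y)) t x y +
      (lam / 4) * (F1 (t, x, y) + F2 (t, x, y) - 4 * F0 (t, x, y)) at h
    rw [pt3_curry (diff hf0), px3_curry (diff hf0)] at h
    rw [transportOp, dirDeriv_add_left, dirDeriv_smul_left, hP]
    simp only [Pi.add_apply, Pi.smul_apply, smul_eq_mul]
    linear_combination h
  have e1 : transportOp (5 * lam / 4) (u + c • w) F1 = (lam / 4) • P := by
    ext ⟨t, x, y⟩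
    have h := heq1 t x y
    change pt3 (fun t x y => F1 (t, x, y)) t x y = -c * py3 (fun t x y => F1 (t, x, y)) t x y +
      (lam / 4) * (F0 (t, x, y) + F2 (t, x, y) - 4 * F1 (t, x, y)) at h
    rw [pt3_curry (diff hf1), py3_curry (diff hf1)] at h
    rw [transportOp, dirDeriv_add_left, dirDeriv_smul_left, hP]
    simp only [Pi.add_apply, Pi.smul_apply, smul_eq_mul]
    linear_combination h
  have e2 : transportOp (5 * lam / 4) u F2 = (lam / 4) • P := by
    ext ⟨t, x, y⟩
    have h := heq2 t x y
    change pt3 (fun t x y => F2 (t, x, y)) t x y =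
      (lam / 4) * (F0 (t, x, y) + F1 (t, x, y) - 4 * F2 (t, x, y)) at h
    rw [pt3_curry (diff hf2)] at h
    rw [transportOp, hP]
    simp only [Pi.add_apply, Pi.smul_apply, smul_eq_mul]
    linear_combination h
  have main := transportOp_elimination_expand hP3
    (transportOp_elimination hf0 hf1 hf2 hP e0 e1 e2)
  have hu2 : ContDiff ℝ 2 (dirDeriv u P) := contDiff_dirDeriv (n := 2) hP3 u
  have huu1 : ContDiff ℝ 1 (dirDeriv u (dirDeriv u P)) := contDiff_dirDeriv (n := 1) hu2 u
  have hP2 : ContDiff ℝ 2 P := hP3.of_le (by norm_num)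
  have hpt : pt3 p = fun t x y => dirDeriv u P (t, x, y) := by rw [hpP, pt3_curry (diff hP3)]
  have hptt : pt3 (pt3 p) = fun t x y => dirDeriv u (dirDeriv u P) (t, x, y) := by
    rw [hpt, pt3_curry (hu2.differentiable (by norm_num))]
  have hpttt : pt3 (pt3 (pt3 p)) =
      fun t x y => dirDeriv u (dirDeriv u (dirDeriv u P)) (t, x, y) := by
    rw [hptt, pt3_curry (huu1.differentiable (by norm_num))]
  set Q : ℝ × ℝ × ℝ → ℝ := dirDeriv u (dirDeriv u P) + (2 * lam) • dirDeriv u P +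
    ((15 / 16) * lam ^ 2) • P with hQ
  set R : ℝ × ℝ × ℝ → ℝ := dirDeriv u P + lam • P with hR
  have hQ1 : ContDiff ℝ 1 Q :=
    (huu1.add ((hu2.of_le (by norm_num)).const_smul (2 * lam))).add
      ((hP3.of_le (by norm_num)).const_smul ((15 / 16) * lam ^ 2))
  have hR2 : ContDiff ℝ 2 R := hu2.add (hP2.const_smul lam)
  have hRw : Differentiable ℝ (dirDeriv w R) :=
    (contDiff_dirDeriv (n := 1) hR2 w).differentiable (by norm_num)
  have hQc : (fun t x y => pt3 (pt3 p) t x y + 2 * lam * pt3 p t x y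
      + (15 / 16) * lam ^ 2 * p t x y) = fun t x y => Q (t, x, y) := by
    rw [hptt, hpt, hpP]; rfl
  have hRc : (fun t x y => pt3 p t x y + lam * p t x y) = fun t x y => R (t, x, y) := by
    rw [hpt, hpP]; rfl
  intro t x y
  rw [hQc, hRc, px3_curry (hQ1.differentiable (by norm_num)),
    py3_curry (hQ1.differentiable (by norm_num)), py3_curry (hR2.differentiable (by norm_num)),
    px3_curry hRw, hpttt, hptt, hpt, hpP]
  rw [show 2 * (5 * lam / 4) - 2 * (lam / 4) = 2 * lam by ring,
    show (5 * lam / 4) ^ 2 - 2 * (lam / 4) * (5 * lam / 4) = 15 / 16 * lam ^ 2 by ring,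
    show 5 * lam / 4 - lam / 4 = lam by ring, ← hQ, ← hR] at main
  have hq := congrFun main (t, x, y)
  simp only [Pi.add_apply, Pi.smul_apply, Pi.sub_apply, smul_eq_mul] at hq
  linear_combination hq
end

section
/- For an integer ν ≥ 0, let I_ν denote the modified Bessel function of the first kind, defined by the everywhere-convergent series I_ν(x) = Σ_{k=0}^∞ (x/2)^{2k+ν} / (k! (k+ν)!). Then for every λ > 0 and t > 0, ∫₀ᵗ (λ/3) e^{−λ(t+s)/2} [2 I₀(λ√(2s(t−s))) + ((2t−s)/√(2s(t−s))) I₁(λ√(2s(t−s)))] ds = 1 − (1/3) e^{−λt} − (2/3) e^{−λt/2}. -/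
/-- The modified Bessel function of the first kind of integer order ν,
defined by its everywhere-convergent power series. -/
noncomputable def besselI (ν : ℕ) (x : ℝ) : ℝ :=
  ∑' k : ℕ, (x / 2) ^ (2 * k + ν) / ((Nat.factorial k : ℝ) * (Nat.factorial (k + ν) : ℝ))

open MeasureTheory

/-- The entire function `∑ uᵏ / (k! (k + ν)!)`, so that
`besselI ν x = (x / 2) ^ ν * besselClifford ν (x ^ 2 / 4)`. -/
noncomputable def besselClifford (ν : ℕ) (u : ℝ) : ℝ :=
  ∑' k : ℕ, u ^ k / ((Nat.factorial k : ℝ) * (Nat.factorial (k + ν) : ℝ))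

theorem summable_besselClifford (ν : ℕ) (u : ℝ) :
    Summable fun k : ℕ => u ^ k / ((Nat.factorial k : ℝ) * (Nat.factorial (k + ν) : ℝ)) := by
  refine Summable.of_norm_bounded (Real.summable_pow_div_factorial |u|) fun k => ?_
  rw [norm_div, norm_pow, Real.norm_eq_abs, Real.norm_of_nonneg (by positivity)]
  have : (1 : ℝ) ≤ (Nat.factorial (k + ν) : ℝ) := by exact_mod_cast Nat.factorial_pos _
  have h0 : (0 : ℝ) < (Nat.factorial k : ℝ) := by exact_mod_cast Nat.factorial_pos _
  gcongr
  nlinarith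

theorem besselI_eq_besselClifford (ν : ℕ) (x : ℝ) :
    besselI ν x = (x / 2) ^ ν * besselClifford ν (x ^ 2 / 4) := by
  rw [besselI, besselClifford, ← tsum_mul_left]
  refine tsum_congr fun k => ?_
  rw [pow_add, pow_mul, div_pow x 2 2, mul_div_assoc', mul_comm ((x / 2) ^ ν)]
  norm_num

theorem hasDerivAt_besselClifford (ν : ℕ) (u : ℝ) :
    HasDerivAt (besselClifford ν) (besselClifford (ν + 1) u) u := by
  set R : ℝ := |u| + 1 with hR
  have hR0 : 0 ≤ R := by positivity
  have hbound : Summable fun k : ℕ => (k : ℝ) * R ^ (k - 1) / (Nat.factorial k : ℝ) := by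
    rw [← summable_nat_add_iff 1]
    refine (Real.summable_pow_div_factorial R).congr fun k => ?_
    rw [Nat.factorial_succ, Nat.add_sub_cancel]
    push_cast
    field_simp
  have hu : u ∈ Metric.ball (0 : ℝ) R := by simp [hR]
  have key := hasDerivAt_tsum_of_isPreconnected
    (g := fun (k : ℕ) (y : ℝ) => y ^ k / ((Nat.factorial k : ℝ) * (Nat.factorial (k + ν) : ℝ)))
    (g' := fun (k : ℕ) (y : ℝ) =>
      (k : ℝ) * y ^ (k - 1) / ((Nat.factorial k : ℝ) * (Nat.factorial (k + ν) : ℝ)))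
    hbound Metric.isOpen_ball (convex_ball (0 : ℝ) R).isPreconnected
    (fun k y _ => (hasDerivAt_pow k y).div_const _)
    (fun k y hy => by
      have hy' : |y| ≤ R := by simpa using (Metric.mem_ball.mp hy).le
      have : (1 : ℝ) ≤ (Nat.factorial (k + ν) : ℝ) := by exact_mod_cast Nat.factorial_pos _
      have h0 : (0 : ℝ) < (Nat.factorial k : ℝ) := by exact_mod_cast Nat.factorial_pos _
      rw [norm_div, norm_mul, norm_pow, Real.norm_eq_abs y, Real.norm_of_nonneg (by positivity),
        Real.norm_of_nonneg (by positivity)]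
      gcongr
      nlinarith)
    hu (summable_besselClifford ν u) hu
  convert! key using 1
  have hs : Summable fun k : ℕ => (k : ℝ) * u ^ (k - 1) /
      ((Nat.factorial k : ℝ) * (Nat.factorial (k + ν) : ℝ)) := by
    rw [← summable_nat_add_iff 1]
    refine (summable_besselClifford (ν + 1) u).congr fun k => ?_
    rw [Nat.factorial_succ k, Nat.add_sub_cancel, show k + 1 + ν = k + (ν + 1) by ring]
    push_cast
    field_simp
  rw [hs.tsum_eq_zero_add, besselClifford]
  simp only [Nat.cast_zero, zero_mul, zero_div, zero_add]
  refine tsum_congr fun k => ?_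
  rw [Nat.factorial_succ k, Nat.add_sub_cancel, show k + 1 + ν = k + (ν + 1) by ring]
  push_cast
  field_simp

theorem differentiable_besselClifford (ν : ℕ) : Differentiable ℝ (besselClifford ν) :=
  fun u => (hasDerivAt_besselClifford ν u).differentiableAt

theorem besselClifford_zero_right (ν : ℕ) :
    besselClifford ν 0 = ((Nat.factorial ν : ℝ))⁻¹ := by
  rw [besselClifford, tsum_eq_single 0 fun k hk => by simp [hk]]
  simp

/-- The three-term recurrence of the Bessel–Clifford functions. -/
theorem besselClifford_recurrence (ν : ℕ) (u : ℝ) :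
    u * besselClifford (ν + 2) u + (ν + 1) * besselClifford (ν + 1) u = besselClifford ν u := by
  have h0 := (summable_besselClifford ν u).tsum_eq_zero_add
  have h1 := (summable_besselClifford (ν + 1) u).tsum_eq_zero_add
  have s0 := (summable_nat_add_iff 1).mpr (summable_besselClifford ν u)
  have s1 := (summable_nat_add_iff 1).mpr (summable_besselClifford (ν + 1) u)
  simp only [besselClifford]
  rw [h0, h1, mul_add, ← tsum_mul_left, ← tsum_mul_left, add_left_comm,
    ← ((summable_besselClifford (ν + 2) u).mul_left u).tsum_add (s1.mul_left _)]
  congr 1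
  · simp only [pow_zero, Nat.factorial_zero, Nat.cast_one, zero_add, Nat.factorial_succ]
    push_cast
    field_simp
  · refine tsum_congr fun k => ?_
    rw [show k + 1 + (ν + 1) = k + ν + 1 + 1 by ring, show k + 1 + ν = k + ν + 1 by ring,
      show k + (ν + 2) = k + ν + 1 + 1 by ring, Nat.factorial_succ k,
      Nat.factorial_succ (k + ν + 1)]
    push_cast
    field_simp
    ring

/-- Integral over a segment of the differential of `(p, q) ↦ P(X ≤ Y)`, where `X` and `Y` are
independent Poisson variables with means `p = a (1 - x)` and `q = b x`. -/
theorem integral_exp_mul_besselClifford (a b : ℝ) :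
    ∫ x in (0 : ℝ)..1, Real.exp (-(a * (1 - x)) - b * x) *
      (a * besselClifford 0 (a * b * x * (1 - x))
        + a * b * (1 - x) * besselClifford 1 (a * b * x * (1 - x))) = 1 - Real.exp (-a) := by
  set f : ℝ × ℝ → ℝ := fun z => -(Real.exp (-(a * (1 - z.1)) - z.2 * z.1) *
    (a * z.1 * (1 - z.1) * besselClifford 1 (a * z.2 * z.1 * (1 - z.1)))) with hf
  set g : ℝ × ℝ → ℝ := fun z => Real.exp (-(a * (1 - z.1)) - z.2 * z.1) *
    (a * besselClifford 0 (a * z.2 * z.1 * (1 - z.1))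
      + a * z.2 * (1 - z.1) * besselClifford 1 (a * z.2 * z.1 * (1 - z.1))) with hg
  have d0 := differentiable_besselClifford 0
  have d1 := differentiable_besselClifford 1
  have df : Differentiable ℝ f := by fun_prop
  have dg : Differentiable ℝ g := by fun_prop
  have hdiv : ∀ z : ℝ × ℝ, fderiv ℝ f z (1, 0) + fderiv ℝ g z (0, 1) = 0 := by
    rintro ⟨x, y⟩
    have hfx : HasDerivAt (fun s => f (s, y)) (fderiv ℝ f (x, y) (1, 0)) x :=
      HasFDerivAt.comp_hasDerivAt (f := fun s => (s, y)) x (df (x, y)).hasFDerivAt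
        ((hasDerivAt_id' x).prodMk (hasDerivAt_const x y))
    have hgy : HasDerivAt (fun s => g (x, s)) (fderiv ℝ g (x, y) (0, 1)) y :=
      HasFDerivAt.comp_hasDerivAt (f := fun s => (x, s)) y (dg (x, y)).hasFDerivAt
        ((hasDerivAt_const y x).prodMk (hasDerivAt_id' y))
    have hux : HasDerivAt (fun s : ℝ => a * y * s * (1 - s)) (a * y * (1 - 2 * x)) x := by
      convert! ((hasDerivAt_id x).const_mul (a * y)).mul ((hasDerivAt_id x).const_sub 1) using 1
      simp only [id]; ring
    have huy : HasDerivAt (fun s : ℝ => a * s * x * (1 - x)) (a * x * (1 - x)) y := by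
      convert! (((hasDerivAt_id y).const_mul a).mul_const x).mul_const (1 - x) using 1
      ring
    have hex : HasDerivAt (fun s : ℝ => Real.exp (-(a * (1 - s)) - y * s))
        (Real.exp (-(a * (1 - x)) - y * x) * (a - y)) x := by
      refine HasDerivAt.exp ?_
      convert! ((((hasDerivAt_id x).const_sub 1).const_mul a).neg).sub
        ((hasDerivAt_id x).const_mul y) using 1
      ring
    have hey : HasDerivAt (fun s : ℝ => Real.exp (-(a * (1 - x)) - s * x))
        (Real.exp (-(a * (1 - x)) - y * x) * (-x)) y := by
      refine HasDerivAt.exp ?_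
      convert! ((hasDerivAt_id y).mul_const x).const_sub (-(a * (1 - x))) using 1
      ring
    have hpx : HasDerivAt (fun s : ℝ => a * s * (1 - s)) (a * (1 - 2 * x)) x := by
      convert! ((hasDerivAt_id x).const_mul a).mul ((hasDerivAt_id x).const_sub 1) using 1
      simp only [id]; ring
    have hpy : HasDerivAt (fun s : ℝ => a * s * (1 - x)) (a * (1 - x)) y := by
      convert! ((hasDerivAt_id y).const_mul a).mul_const (1 - x) using 1
      ring
    have hfx' := (hex.mul (hpx.mul ((hasDerivAt_besselClifford 1 _).comp x hux))).neg
    have hgy' := hey.mul ((((hasDerivAt_besselClifford 0 _).comp y huy).const_mul a).add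
      (hpy.mul ((hasDerivAt_besselClifford 1 _).comp y huy)))
    rw [hfx.unique hfx', hgy.unique hgy']
    have hrec := besselClifford_recurrence 0 (a * y * x * (1 - x))
    simp only [Pi.mul_apply, Pi.add_apply, Function.comp_apply, Nat.cast_zero, zero_add,
      one_mul, Nat.reduceAdd] at hrec ⊢
    rw [← hrec]
    ring
  have key := integral2_divergence_prod_of_hasFDerivAt f g (fderiv ℝ f) (fderiv ℝ g) 0 0 1 b
    df.continuous.continuousOn dg.continuous.continuousOn
    (fun z _ => (df z).hasFDerivAt) (fun z _ => (dg z).hasFDerivAt)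
    (by simp only [hdiv]; exact integrableOn_zero)
  have hf0 : ∀ y, f (0, y) = 0 := fun y => by simp [hf]
  have hf1 : ∀ y, f (1, y) = 0 := fun y => by simp [hf]
  have hg0 : ∀ x, g (x, 0) = a * Real.exp (-(a * (1 - x))) := fun x => by
    simp [hg, besselClifford_zero_right, mul_comm]
  simp only [hdiv, hf0, hf1, hg0, intervalIntegral.integral_zero, add_zero, sub_zero] at key
  have hprim : ∫ x in (0 : ℝ)..1, a * Real.exp (-(a * (1 - x))) = 1 - Real.exp (-a) := by
    have h := intervalIntegral.integral_eq_sub_of_hasDerivAt (a := 0) (b := 1)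
      (f := fun x : ℝ => Real.exp (-(a * (1 - x)))) (f' := fun x => a * Real.exp (-(a * (1 - x))))
      (fun x _ => by
        convert! (((hasDerivAt_id x).const_sub 1).const_mul a).neg.exp using 1
        simp only [id, Pi.neg_apply]; ring)
      (Continuous.intervalIntegrable (by fun_prop) _ _)
    simpa using h
  rw [← hprim]
  linarith [key]

theorem Tz_density_normalization
    (lam t : ℝ) (hlam : 0 < lam) (ht : 0 < t) :
    ∫ s in (0 : ℝ)..t, (lam / 3) * Real.exp (-lam * (t + s) / 2) *
      (2 * besselI 0 (lam * Real.sqrt (2 * s * (t - s)))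
        + ((2 * t - s) / Real.sqrt (2 * s * (t - s)))
            * besselI 1 (lam * Real.sqrt (2 * s * (t - s))))
    = 1 - (1 / 3) * Real.exp (-lam * t) - (2 / 3) * Real.exp (-lam * t / 2) := by
  set F : ℝ → ℝ := fun s => (lam / 3) * Real.exp (-lam * (t + s) / 2) *
    (2 * besselClifford 0 (lam ^ 2 * s * (t - s) / 2)
      + (2 * t - s) * (lam / 2) * besselClifford 1 (lam ^ 2 * s * (t - s) / 2)) with hF
  set G : ℝ → ℝ → ℝ → ℝ := fun a b x => Real.exp (-(a * (1 - x)) - b * x) *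
      (a * besselClifford 0 (a * b * x * (1 - x))
        + a * b * (1 - x) * besselClifford 1 (a * b * x * (1 - x))) with hG
  have d0 := (differentiable_besselClifford 0).continuous
  have d1 := (differentiable_besselClifford 1).continuous
  have hGc : ∀ a b, Continuous (G a b) := fun a b => by fun_prop
  have hcongr : Set.EqOn (fun s => (lam / 3) * Real.exp (-lam * (t + s) / 2) *
      (2 * besselI 0 (lam * Real.sqrt (2 * s * (t - s)))
        + ((2 * t - s) / Real.sqrt (2 * s * (t - s)))
            * besselI 1 (lam * Real.sqrt (2 * s * (t - s))))) F (Set.Ioo 0 t) := by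
    intro s hs
    have hpos : 0 < 2 * s * (t - s) := mul_pos (by linarith [hs.1]) (by linarith [hs.2])
    have hne := (Real.sqrt_pos.mpr hpos).ne'
    have hsq : (lam * Real.sqrt (2 * s * (t - s))) ^ 2 / 4 = lam ^ 2 * s * (t - s) / 2 := by
      rw [mul_pow, Real.sq_sqrt hpos.le]; ring
    simp only [hF, besselI_eq_besselClifford, hsq]
    generalize Real.sqrt (2 * s * (t - s)) = w at hne ⊢
    field_simp
  rw [intervalIntegral.integral_congr_Ioo_of_le ht.le hcongr]
  have hscale : ∫ s in (0 : ℝ)..t, F s = ∫ x in (0 : ℝ)..1, t * F (t * x) := by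
    rw [intervalIntegral.integral_const_mul, intervalIntegral.mul_integral_comp_mul_left]
    simp
  have hsplit : ∀ x, t * F (t * x) =
      2 / 3 * G (lam * t / 2) (lam * t) x + 1 / 3 * G (lam * t) (lam * t / 2) (1 - x) := by
    intro x
    have e1 : lam ^ 2 * (t * x) * (t - t * x) / 2 = lam * t / 2 * (lam * t) * x * (1 - x) := by ring
    have e2 : lam * t * (lam * t / 2) * (1 - x) * (1 - (1 - x)) =
      lam * t / 2 * (lam * t) * x * (1 - x) := by ring
    have e3 : -lam * (t + t * x) / 2 = -(lam * t / 2 * (1 - x)) - lam * t * x := by ring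
    have e4 : -(lam * t * (1 - (1 - x))) - lam * t / 2 * (1 - x) =
      -(lam * t / 2 * (1 - x)) - lam * t * x := by ring
    simp only [hF, hG, e1, e2, e3, e4]
    ring
  have hrefl : ∫ x in (0 : ℝ)..1, G (lam * t) (lam * t / 2) (1 - x) =
      ∫ x in (0 : ℝ)..1, G (lam * t) (lam * t / 2) x := by
    simp [intervalIntegral.integral_comp_sub_left (G (lam * t) (lam * t / 2))]
  rw [hscale]
  simp only [hsplit]
  have hGr : Continuous fun x => G (lam * t) (lam * t / 2) (1 - x) :=
    (hGc _ _).comp (continuous_sub_left 1)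
  rw [intervalIntegral.integral_add (((hGc _ _).const_mul _).intervalIntegrable _ _)
      ((hGr.const_mul _).intervalIntegrable _ _),
    intervalIntegral.integral_const_mul, intervalIntegral.integral_const_mul, hrefl,
    integral_exp_mul_besselClifford, integral_exp_mul_besselClifford]
  rw [show -(lam * t / 2) = -lam * t / 2 by ring, show -(lam * t) = -lam * t by ring]
  ring
end

section
/- For an integer ν ≥ 0, let I_ν denote the modified Bessel function of the first kind, defined by the everywhere-convergent series I_ν(x) = Σ_{k=0}^∞ (x/2)^{2k+ν} / (k! (k+ν)!). Let λ, c, t > 0 and let x be a real number with |x| < ct. Then e^{−2λt} (c²t²−x²)^{−1/2} ∫₀^∞ e^{−w²} w³ I₁(w√(2λ(ct−x)/c)) I₁(w√(2λ(ct+x)/c)) dw = (e^{−λt}/(2c)) [ λ I₀((λ/c)√(c²t²−x²)) + (λct/√(c²t²−x²)) I₁((λ/c)√(c²t²−x²)) ]. -/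
section BesselSeries

open Finset Real
open scoped Nat

/-- The entire function `y ↦ ∑ k, y ^ k / (k! (k + r)!)`, so that
`besselI r x = (x / 2) ^ r * besselSeries r ((x / 2) ^ 2)`. -/
noncomputable def besselSeries (r : ℕ) (y : ℝ) : ℝ :=
  ∑' k : ℕ, y ^ k / ((k ! : ℝ) * ((k + r)! : ℝ))

lemma summable_besselSeries (r : ℕ) {y : ℝ} (hy : 0 ≤ y) :
    Summable fun k : ℕ => y ^ k / ((k ! : ℝ) * ((k + r)! : ℝ)) := by
  refine Summable.of_nonneg_of_le (fun k => by positivity) (fun k => ?_)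
    (Real.summable_pow_div_factorial y)
  have h : (1 : ℝ) ≤ ((k + r)! : ℝ) := by exact_mod_cast Nat.succ_le_of_lt (Nat.factorial_pos _)
  have hk : (0 : ℝ) < (k ! : ℝ) := by positivity
  gcongr
  nlinarith

lemma besselI_eq_pow_mul_besselSeries (r : ℕ) (x : ℝ) :
    besselI r x = (x / 2) ^ r * besselSeries r ((x / 2) ^ 2) := by
  rw [besselI, besselSeries, ← tsum_mul_left]
  refine tsum_congr fun k => ?_
  rw [pow_add, pow_mul]
  ring

lemma hasSum_pow_div_factorial (y : ℝ) : HasSum (fun n : ℕ => y ^ n / (n ! : ℝ)) (exp y) := by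
  rw [Real.exp_eq_exp_ℝ]
  exact NormedSpace.expSeries_div_hasSum_exp y

lemma HasSum.congr_of_eq {ι : Type*} {f g : ι → ℝ} {a b : ℝ} (h : HasSum f a)
    (hfg : ∀ i, g i = f i) (hab : b = a) : HasSum g b := by
  rwa [hab, funext hfg]

lemma hasSum_prod_of_nonneg {f : ℕ × ℕ → ℝ} {g : ℕ → ℝ} {s : ℝ} (hf : ∀ p, 0 ≤ f p)
    (hfg : ∀ k, HasSum (fun j => f (k, j)) (g k)) (hg : HasSum g s) : HasSum f s := by
  have hsum : Summable f := by
    refine (summable_prod_of_nonneg hf).2 ⟨fun k => (hfg k).summable, ?_⟩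
    simpa only [(hfg _).tsum_eq] using hg.summable
  have h := hsum.hasSum.prod_fiberwise hfg
  rw [hg.unique h]
  exact hsum.hasSum

lemma sum_range_choose_mul_choose_add (r j k : ℕ) :
    ∑ m ∈ range (j + 1), j.choose m * (k + r).choose (m + r) =
      (j + k + r).choose (j + r) := by
  have h := Nat.add_choose_eq (k + r) j (j + r)
  rw [Nat.sum_antidiagonal_eq_sum_range_succ
    (fun a b => (k + r).choose a * j.choose b)] at h
  rw [show (j + r).succ = r + (j + 1) by omega, sum_range_add, sum_eq_zero, zero_add] at h
  · rw [show j + k + r = k + r + j by omega, h]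
    refine sum_congr rfl fun m hm => ?_
    have hm' : m ≤ j := by simpa [Nat.lt_succ_iff] using hm
    rw [show j + r - (r + m) = j - m by omega, Nat.choose_symm hm', add_comm r m, mul_comm]
  · intro i hi
    have : i < r := by simpa using hi
    rw [Nat.choose_eq_zero_of_lt (show j < j + r - i by omega), mul_zero]

lemma hasSum_exp_mul_besselSeries (r : ℕ) {u v : ℝ} (hu : 0 ≤ u) (hv : 0 ≤ v) :
    HasSum (fun p : ℕ × ℕ => ((p.1 + p.2 + r)! : ℝ) /
        ((p.1 ! : ℝ) * ((p.1 + r)! : ℝ) * ((p.2 ! : ℝ) * ((p.2 + r)! : ℝ))) * u ^ p.1 * v ^ p.2)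
      (exp (u + v) * besselSeries r (u * v)) := by
  set P : ℕ → ℕ → ℝ := fun k m =>
    v ^ m * ((k + r).choose (m + r) : ℝ) / ((m ! : ℝ) * ((k + r)! : ℝ)) with hP
  have hPzero : ∀ k, ∀ m ∉ range (k + 1), P k m = 0 := by
    intro k m hm
    have : k < m := by simpa [Nat.lt_succ_iff] using hm
    simp [hP, Nat.choose_eq_zero_of_lt (show k + r < m + r by omega)]
  have hPsum : ∀ k, HasSum (P k) (∑ m ∈ range (k + 1), P k m) := fun k =>
    hasSum_sum_of_ne_finset_zero (hPzero k)
  refine hasSum_prod_of_nonneg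
    (g := fun k => u ^ k * ((∑ m ∈ range (k + 1), P k m) * exp v))
    (fun p => by positivity) (fun k => ?_) ?_
  · have h := hasSum_sum_range_mul_of_summable_norm (hPsum k).summable.norm
      (hasSum_pow_div_factorial v).summable.norm
    rw [(hPsum k).tsum_eq, (hasSum_pow_div_factorial v).tsum_eq] at h
    refine (h.mul_left (u ^ k)).congr_of_eq (fun j => ?_) rfl
    have hterm : ∀ m ∈ range (j + 1), P k m * (v ^ (j - m) / ((j - m)! : ℝ)) =
        v ^ j / ((j ! : ℝ) * ((k + r)! : ℝ)) *
          ((j.choose m * (k + r).choose (m + r) : ℕ) : ℝ) := by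
      intro m hm
      have hm' : m ≤ j := by simpa [Nat.lt_succ_iff] using hm
      obtain ⟨n, rfl⟩ := Nat.exists_eq_add_of_le hm'
      simp only [hP]
      rw [Nat.cast_mul, Nat.cast_add_choose ℝ, Nat.add_sub_cancel_left]
      field_simp
      ring
    rw [sum_congr rfl hterm, ← mul_sum, ← Nat.cast_sum, sum_range_choose_mul_choose_add,
      show j + k + r = (j + r) + k by omega, Nat.cast_add_choose ℝ]
    dsimp only
    rw [show k + j + r = j + r + k by omega]
    field_simp
  · have h := hasSum_sum_range_mul_of_summable_norm
      (summable_besselSeries r (mul_nonneg hu hv)).norm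
      (hasSum_pow_div_factorial u).summable.norm
    rw [(hasSum_pow_div_factorial u).tsum_eq] at h
    refine (h.mul_right (exp v)).congr_of_eq (fun k => ?_) ?_
    · rw [← mul_assoc, mul_sum]
      congr 1
      refine sum_congr rfl fun m hm => ?_
      have hm' : m ≤ k := by simpa [Nat.lt_succ_iff] using hm
      obtain ⟨n, rfl⟩ := Nat.exists_eq_add_of_le hm'
      simp only [hP]
      rw [show m + n + r = (m + r) + n by omega, Nat.cast_add_choose ℝ, Nat.add_sub_cancel_left]
      field_simp
      ring
    · rw [exp_add, besselSeries]; ring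

lemma hasSum_add_factorial_two {u v : ℝ} (hu : 0 ≤ u) (hv : 0 ≤ v) :
    HasSum (fun p : ℕ × ℕ => ((p.1 + p.2 + 2)! : ℝ) /
        ((p.1 ! : ℝ) * ((p.1 + 1)! : ℝ) * ((p.2 ! : ℝ) * ((p.2 + 1)! : ℝ))) * u ^ p.1 * v ^ p.2)
      (exp (u + v) * ((u + v) * besselSeries 1 (u * v) + 2 * besselSeries 0 (u * v))) := by
  have h1 := hasSum_exp_mul_besselSeries 1 hu hv
  have h0 := hasSum_exp_mul_besselSeries 0 hu hv
  set c : ℕ × ℕ → ℝ := fun p => ((p.1 + p.2)! : ℝ) /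
        ((p.1 ! : ℝ) * ((p.1 + 1)! : ℝ) * ((p.2 ! : ℝ) * ((p.2 + 1)! : ℝ))) * u ^ p.1 * v ^ p.2
    with hc
  have hu1 : HasSum (fun p : ℕ × ℕ => (p.1 : ℝ) * (p.1 + 1) * c p)
      (u * (exp (u + v) * besselSeries 1 (u * v))) := by
    refine (Function.Injective.hasSum_iff (g := fun p : ℕ × ℕ => (p.1 + 1, p.2))
      (fun p q h => by simpa [Prod.ext_iff] using h) ?_).1 ?_
    · rintro ⟨_ | k, j⟩ h
      · simp
      · exact absurd ⟨(k, j), rfl⟩ h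
    · refine (h1.mul_left u).congr_of_eq (fun ⟨k, j⟩ => ?_) rfl
      simp only [hc, Function.comp_apply, Nat.factorial_succ,
        Nat.add_right_comm _ 1]
      push_cast
      field_simp
      ring
  have hv1 : HasSum (fun p : ℕ × ℕ => (p.2 : ℝ) * (p.2 + 1) * c p)
      (v * (exp (u + v) * besselSeries 1 (u * v))) := by
    refine (Function.Injective.hasSum_iff (g := fun p : ℕ × ℕ => (p.1, p.2 + 1))
      (fun p q h => by simpa [Prod.ext_iff] using h) ?_).1 ?_
    · rintro ⟨k, _ | j⟩ h
      · simp
      · exact absurd ⟨(k, j), rfl⟩ h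
    · refine (h1.mul_left v).congr_of_eq (fun ⟨k, j⟩ => ?_) rfl
      simp only [hc, Function.comp_apply, Nat.factorial_succ, ← Nat.add_assoc]
      push_cast
      field_simp
      ring
  refine ((hu1.add hv1).add (h0.mul_left 2)).congr_of_eq (fun ⟨k, j⟩ => ?_) ?_
  · simp only [hc, Nat.factorial_succ, add_zero]
    push_cast
    field_simp
    ring
  · ring

lemma integral_pow_mul_exp_neg_sq (n : ℕ) :
    ∫ w in Set.Ioi (0 : ℝ), w ^ (2 * n + 1) * exp (-w ^ 2) = (n ! : ℝ) / 2 := by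
  have h := integral_rpow_mul_exp_neg_rpow (p := 2) (q := ((2 * n + 1 : ℕ) : ℝ)) (by norm_num)
    (by push_cast; linarith [(Nat.cast_nonneg n : (0 : ℝ) ≤ n)])
  simp only [rpow_natCast, rpow_ofNat] at h
  rw [h, show (((2 * n + 1 : ℕ) : ℝ) + 1) / 2 = n + 1 by push_cast; ring,
    Gamma_nat_eq_factorial]
  ring

lemma integrableOn_pow_mul_exp_neg_sq (n : ℕ) :
    MeasureTheory.IntegrableOn (fun w : ℝ => w ^ (2 * n + 1) * exp (-w ^ 2)) (Set.Ioi 0) := by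
  refine MeasureTheory.Integrable.of_integral_ne_zero ?_
  rw [integral_pow_mul_exp_neg_sq]
  positivity

lemma besselI_one_mul_besselI_one_eq_tsum (a b w : ℝ) :
    besselI 1 (w * (2 * a)) * besselI 1 (w * (2 * b)) =
      ∑' p : ℕ × ℕ, a * b * w ^ 2 * ((a ^ 2) ^ p.1 * (b ^ 2) ^ p.2 * w ^ (2 * (p.1 + p.2)) /
        ((p.1 ! : ℝ) * ((p.1 + 1)! : ℝ) * ((p.2 ! : ℝ) * ((p.2 + 1)! : ℝ)))) := by
  have ha := summable_besselSeries 1 (sq_nonneg (w * a))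
  have hb := summable_besselSeries 1 (sq_nonneg (w * b))
  have hab := ha.mul_of_nonneg hb (fun _ => by positivity) (fun _ => by positivity)
  have h := ha.tsum_mul_tsum hb hab
  rw [besselI_eq_pow_mul_besselSeries, besselI_eq_pow_mul_besselSeries, besselSeries,
    besselSeries, show w * (2 * a) / 2 = w * a by ring, show w * (2 * b) / 2 = w * b by ring,
    mul_mul_mul_comm, h, ← tsum_mul_left]
  refine tsum_congr fun p => ?_
  ring

/-- Obtained from Weber's second exponential integral by differentiating in the Gaussian weight. -/
lemma integral_exp_neg_sq_mul_besselI_one_mul_besselI_one {a b : ℝ} (ha : 0 ≤ a) (hb : 0 ≤ b) :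
    ∫ w in Set.Ioi (0 : ℝ),
        exp (-w ^ 2) * w ^ 3 * besselI 1 (w * (2 * a)) * besselI 1 (w * (2 * b)) =
      exp (a ^ 2 + b ^ 2) / 2 *
        ((a ^ 2 + b ^ 2) * besselI 1 (2 * a * b) + 2 * a * b * besselI 0 (2 * a * b)) := by
  set C : ℕ × ℕ → ℝ := fun p => a * b * ((a ^ 2) ^ p.1 * (b ^ 2) ^ p.2 /
    ((p.1 ! : ℝ) * ((p.1 + 1)! : ℝ) * ((p.2 ! : ℝ) * ((p.2 + 1)! : ℝ)))) with hC
  set F : ℕ × ℕ → ℝ → ℝ := fun p w =>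
    C p * (w ^ (2 * (p.1 + p.2 + 2) + 1) * exp (-w ^ 2)) with hF
  have hFint : ∀ p, ∫ w in Set.Ioi (0 : ℝ), F p w = C p * (((p.1 + p.2 + 2)! : ℝ) / 2) := by
    intro p
    simp only [hF]
    rw [MeasureTheory.integral_const_mul, integral_pow_mul_exp_neg_sq]
  have hFnorm : ∀ p, ∫ w in Set.Ioi (0 : ℝ), ‖F p w‖ = ∫ w in Set.Ioi (0 : ℝ), F p w := by
    intro p
    refine MeasureTheory.setIntegral_congr_fun measurableSet_Ioi fun w hw => ?_
    have hw' : (0 : ℝ) < w := hw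
    exact norm_of_nonneg (by positivity)
  have hsum : HasSum (fun p => ∫ w in Set.Ioi (0 : ℝ), F p w)
      (a * b / 2 * (exp (a ^ 2 + b ^ 2) * ((a ^ 2 + b ^ 2) * besselSeries 1 (a ^ 2 * b ^ 2) +
        2 * besselSeries 0 (a ^ 2 * b ^ 2)))) := by
    refine ((hasSum_add_factorial_two (sq_nonneg a) (sq_nonneg b)).mul_left
      (a * b / 2)).congr_of_eq (fun p => ?_) rfl
    rw [hFint]
    simp only [hC]
    ring
  have hint := MeasureTheory.hasSum_integral_of_summable_integral_norm
    (μ := MeasureTheory.volume.restrict (Set.Ioi (0 : ℝ))) (F := F)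
    (fun p => (integrableOn_pow_mul_exp_neg_sq _).const_mul (C p))
    (by simpa only [hFnorm] using hsum.summable)
  have hF' : ∀ w, ∑' p, F p w =
      exp (-w ^ 2) * w ^ 3 * besselI 1 (w * (2 * a)) * besselI 1 (w * (2 * b)) := by
    intro w
    rw [mul_assoc, besselI_one_mul_besselI_one_eq_tsum, ← tsum_mul_left]
    refine tsum_congr fun p => ?_
    simp only [hF, hC]
    ring
  simp only [hF'] at hint
  rw [hint.unique hsum, besselI_eq_pow_mul_besselSeries, besselI_eq_pow_mul_besselSeries,
    show (2 * a * b / 2) ^ 2 = a ^ 2 * b ^ 2 by ring]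
  ring

end BesselSeries

theorem telegraph_integral_equals_closed_form
    (lam c t x : ℝ) (hlam : 0 < lam) (hc : 0 < c) (ht : 0 < t)
    (hx : |x| < c * t) :
    Real.exp (-2 * lam * t) * (c ^ 2 * t ^ 2 - x ^ 2) ^ (-(1 : ℝ) / 2) *
        ∫ w in Set.Ioi (0 : ℝ),
          Real.exp (-w ^ 2) * w ^ 3 *
            besselI 1 (w * Real.sqrt (2 * lam * (c * t - x) / c)) *
            besselI 1 (w * Real.sqrt (2 * lam * (c * t + x) / c))
    = Real.exp (-lam * t) / (2 * c) *
        (lam * besselI 0 ((lam / c) * Real.sqrt (c ^ 2 * t ^ 2 - x ^ 2))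
          + (lam * c * t / Real.sqrt (c ^ 2 * t ^ 2 - x ^ 2)) *
              besselI 1 ((lam / c) * Real.sqrt (c ^ 2 * t ^ 2 - x ^ 2))) := by
  obtain ⟨hx1, hx2⟩ := abs_lt.1 hx
  have hm : 0 < c * t - x := by linarith
  have hp : 0 < c * t + x := by linarith
  have hd : c ^ 2 * t ^ 2 - x ^ 2 = (c * t - x) * (c * t + x) := by ring
  have hd0 : 0 < c ^ 2 * t ^ 2 - x ^ 2 := hd ▸ mul_pos hm hp
  set α := Real.sqrt (2 * lam * (c * t - x) / c) with hα
  set β := Real.sqrt (2 * lam * (c * t + x) / c) with hβ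
  set s := Real.sqrt (c ^ 2 * t ^ 2 - x ^ 2) with hs
  have hs0 : 0 < s := Real.sqrt_pos.2 hd0
  have hα2 : α ^ 2 = 2 * lam * (c * t - x) / c := Real.sq_sqrt (by positivity)
  have hβ2 : β ^ 2 = 2 * lam * (c * t + x) / c := Real.sq_sqrt (by positivity)
  have hrpow : (c ^ 2 * t ^ 2 - x ^ 2) ^ (-(1 : ℝ) / 2) = s⁻¹ := by
    rw [neg_div, Real.rpow_neg hd0.le, ← Real.sqrt_eq_rpow]
  have hαβ : α * (β / 2) = lam / c * s := by
    have h : α * β = 2 * lam / c * s := by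
      rw [hα, hβ, ← Real.sqrt_mul (by positivity),
        show 2 * lam * (c * t - x) / c * (2 * lam * (c * t + x) / c) =
          (2 * lam / c) ^ 2 * (c ^ 2 * t ^ 2 - x ^ 2) by ring,
        Real.sqrt_mul (by positivity), Real.sqrt_sq (by positivity)]
    linear_combination h / 2
  have hadd : (α / 2) ^ 2 + (β / 2) ^ 2 = lam * t := by
    rw [div_pow, div_pow, hα2, hβ2]
    field_simp
    ring
  have hint := integral_exp_neg_sq_mul_besselI_one_mul_besselI_one
    (a := α / 2) (b := β / 2) (by positivity) (by positivity)
  rw [mul_div_cancel₀ α two_ne_zero, mul_div_cancel₀ β two_ne_zero, hαβ, hadd] at hint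
  rw [hint, hrpow, show -2 * lam * t = -lam * t + -(lam * t) by ring, Real.exp_add,
    Real.exp_neg (lam * t)]
  field_simp
  ring
end
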